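/- Let G = L_n be the path graph on vertices 1,…,n, and let λ, μ ∈ ℕ^n with λ_1 ≥ λ_2 ≥ … ≥ λ_n and μ_1 ≥ μ_2 ≥ … ≥ μ_n (integer partitions with at most n parts). Then μ ≤ λ in toppling dominance if and only if Σ_{i=1}^n μ_i = Σ_{i=1}^n λ_i and Σ_{i=1}^k μ_i ≤ Σ_{i=1}^k λ_i for all 1 ≤ k ≤ n; that is, on partitions the toppling dominance for the path graph coincides with the classical dominance order. -/

import Mathlib

open Finset

/-- The toppling vector `Δ_i` of vertex `i` in the graph `G`:
it has `-(deg i)` at position `i`, `1` at each neighbor of `i`, and `0` elsewhere. -/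
def topDelta {n : ℕ} (G : SimpleGraph (Fin n)) [DecidableRel G.Adj] (i : Fin n) :
    Fin n → ℤ :=
  fun j => if j = i then -(G.degree i : ℤ) else if G.Adj i j then 1 else 0

/-- The map `T^a : ℤ^n → ℤ^n`, `α ↦ α + Σ_i a_i • Δ_i`. -/
def topT {n : ℕ} (G : SimpleGraph (Fin n)) [DecidableRel G.Adj] (a : Fin n → ℤ)
    (α : Fin n → ℤ) : Fin n → ℤ :=
  α + ∑ i, a i • topDelta G i

/-- Toppling dominance: `β ≤ α` iff `β = T^λ(α)` for some weakly decreasing `λ ∈ ℕ^n`. -/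
def topDom {n : ℕ} (G : SimpleGraph (Fin n)) [DecidableRel G.Adj]
    (β α : Fin n → ℤ) : Prop :=
  ∃ l : Fin n → ℕ, Antitone l ∧ β = topT G (fun i => (l i : ℤ)) α

/-- The path graph on `{1,…,n}`, with edges `{i, i+1}`. -/
def pathG (n : ℕ) : SimpleGraph (Fin n) :=
  SimpleGraph.fromRel (fun i j => (i : ℕ) + 1 = (j : ℕ))

instance pathG.adjDecidable (n : ℕ) : DecidableRel (pathG n).Adj := fun a b =>
  decidable_of_iff (a ≠ b ∧ ((a : ℕ) + 1 = (b : ℕ) ∨ (b : ℕ) + 1 = (a : ℕ)))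
    (by simp [pathG, SimpleGraph.fromRel_adj])

/-- The value of `Σ_i a_i • Δ_i` at a vertex is the net flow of `a` from its neighbors. -/
theorem sum_smul_topDelta_apply {n : ℕ} (G : SimpleGraph (Fin n)) [DecidableRel G.Adj]
    (a : Fin n → ℤ) (j : Fin n) :
    (∑ i, a i • topDelta G i) j = ∑ i, if G.Adj i j then a i - a j else 0 := by
  have hdeg : (G.degree j : ℤ) = ∑ i, if G.Adj i j then 1 else 0 := by
    rw [← SimpleGraph.card_neighborFinset_eq_degree, SimpleGraph.neighborFinset_eq_filter,
      Finset.card_filter]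
    push_cast
    simp only [G.adj_comm]
  have hterm : ∀ i, (a i • topDelta G i) j =
      (if G.Adj i j then a i else 0) - if i = j then a j * (G.degree j : ℤ) else 0 := by
    intro i
    by_cases hij : i = j
    · subst hij
      simp [topDelta]
    · have hji : j ≠ i := fun h => hij h.symm
      simp [topDelta, hij, hji]
  rw [Finset.sum_apply, Finset.sum_congr rfl fun i _ => hterm i, Finset.sum_sub_distrib,
    Finset.sum_ite_eq' univ j, if_pos (mem_univ j), hdeg, Finset.mul_sum,
    ← Finset.sum_sub_distrib]
  exact Finset.sum_congr rfl fun i _ => by split_ifs <;> simp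

/-- The difference `A k - A (k - 1)` along the edge of the path entering vertex `k`, and `0` if
there is no such edge. -/
def pathFlow (n : ℕ) (A : ℕ → ℤ) (k : ℕ) : ℤ :=
  if 0 < k ∧ k < n then A k - A (k - 1) else 0

theorem pathG_adj_iff {n : ℕ} (i j : Fin n) :
    (pathG n).Adj i j ↔ (i : ℕ) + 1 = j ∨ (i : ℕ) = j + 1 := by
  simp only [pathG, SimpleGraph.fromRel_adj, ne_eq, Fin.ext_iff]
  omega

theorem sum_fin_ite_eq (n m : ℕ) (c : ℤ) :
    (∑ i : Fin n, if (i : ℕ) = m then c else 0) = if m < n then c else 0 := by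
  rw [Fin.sum_univ_eq_sum_range (fun i => if i = m then c else 0) n]
  simp

theorem topT_pathG_apply {n : ℕ} (A : ℕ → ℤ) (α : Fin n → ℤ) (j : Fin n) :
    topT (pathG n) (fun i => A i) α j = α j + (pathFlow n A (j + 1) - pathFlow n A j) := by
  have hterm : ∀ i : Fin n, (if (pathG n).Adj i j then A i - A j else 0) =
      (if (i : ℕ) = j + 1 then A (j + 1) - A j else 0) +
        if (i : ℕ) = j - 1 then (if 0 < (j : ℕ) then A (j - 1) - A j else 0) else 0 := by
    intro i
    simp only [pathG_adj_iff]
    by_cases h₁ : (i : ℕ) = j + 1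
    · have h₂ : ¬ (i : ℕ) = j - 1 := by omega
      simp [h₁]
      omega
    · by_cases h₂ : (i : ℕ) + 1 = j
      · simp [← h₂]
        omega
      · by_cases h₃ : 0 < (j : ℕ)
        · have h₄ : ¬ (i : ℕ) = j - 1 := by omega
          simp [h₁, h₂, h₄]
        · simp [h₁, h₂, h₃]
  rw [topT, Pi.add_apply, sum_smul_topDelta_apply, Finset.sum_congr rfl fun i _ => hterm i,
    Finset.sum_add_distrib, sum_fin_ite_eq, sum_fin_ite_eq]
  have hj := j.isLt
  have hj' : (j : ℕ) - 1 < n := by omega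
  simp only [pathFlow, hj, hj', Nat.add_sub_cancel, Nat.succ_pos, true_and, and_true, if_true]
  split_ifs <;> ring

/-- Partial sum of the entries of `f` with index less than `k`. -/
def partialSum {n : ℕ} (f : Fin n → ℕ) (k : ℕ) : ℕ :=
  ∑ i ∈ Finset.univ.filter (fun i : Fin n => (i : ℕ) < k), f i

theorem partialSum_zero {n : ℕ} (f : Fin n → ℕ) : partialSum f 0 = 0 := by
  simp [partialSum]

theorem partialSum_self {n : ℕ} (f : Fin n → ℕ) : partialSum f n = ∑ i, f i := by
  simp [partialSum]

theorem partialSum_succ {n : ℕ} (f : Fin n → ℕ) (j : Fin n) :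
    partialSum f (j + 1) = partialSum f j + f j := by
  have h : Finset.univ.filter (fun i : Fin n => (i : ℕ) < j + 1) =
      insert j (Finset.univ.filter fun i : Fin n => (i : ℕ) < j) := by
    ext i
    simp only [mem_filter, mem_univ, true_and, mem_insert, Fin.ext_iff]
    omega
  rw [partialSum, h, Finset.sum_insert (by simp), partialSum, add_comm]

/-- The partial sums of `T^A(l)` differ from those of `l` by the flow along the cut edge. -/
theorem eq_topT_pathG_iff {n : ℕ} (A : ℕ → ℤ) (l μ : Fin n → ℕ) :
    ((fun i => (μ i : ℤ)) = topT (pathG n) (fun i => A i) fun i => (l i : ℤ)) ↔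
      ∀ k ≤ n, (partialSum μ k : ℤ) = partialSum l k + pathFlow n A k := by
  constructor
  · intro h k
    induction k with
    | zero => simp [partialSum_zero, pathFlow]
    | succ k ih =>
      intro hk
      have hs := congrFun h ⟨k, hk⟩
      rw [topT_pathG_apply] at hs
      have hμ := partialSum_succ μ ⟨k, hk⟩
      have hl := partialSum_succ l ⟨k, hk⟩
      have := ih (by omega)
      simp only at hs hμ hl
      rw [hμ, hl]
      push_cast
      linarith
  · intro h
    ext j
    rw [topT_pathG_apply]
    have h₁ := h (j + 1) j.isLt
    have h₂ := h j j.isLt.le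
    rw [partialSum_succ, partialSum_succ] at h₁
    push_cast at h₁
    linarith

/-- For the path graph, toppling dominance restricted to partitions with at most
`n` parts is the classical dominance order: `μ ≤ λ` iff they have the same size
and all partial sums of `μ` are bounded by those of `λ`. -/
theorem pathG_topDom_iff_dominance (n : ℕ) (hn : 2 ≤ n) (l μ : Fin n → ℕ)
    (hl : Antitone l) (hμ : Antitone μ) :
    topDom (pathG n) (fun i => (μ i : ℤ)) (fun i => (l i : ℤ)) ↔
      (∑ i, μ i = ∑ i, l i) ∧
        ∀ k : ℕ, 1 ≤ k → k ≤ n →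
          ∑ i ∈ Finset.univ.filter (fun i : Fin n => (i : ℕ) < k), μ i ≤
            ∑ i ∈ Finset.univ.filter (fun i : Fin n => (i : ℕ) < k), l i := by
  change _ ↔ (∑ i, μ i = ∑ i, l i) ∧ ∀ k, 1 ≤ k → k ≤ n → partialSum μ k ≤ partialSum l k
  constructor
  · rintro ⟨a, ha, h⟩
    let A : ℕ → ℤ := fun k => if hk : k < n then (a ⟨k, hk⟩ : ℤ) else 0
    have hA : (fun i => (a i : ℤ)) = fun i : Fin n => A i := by
      ext i
      simp [A]
    rw [hA, eq_topT_pathG_iff] at h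
    constructor
    · have := h n le_rfl
      rw [partialSum_self, partialSum_self] at this
      simpa [pathFlow, ← Nat.cast_sum] using this
    · intro k hk hkn
      have hflow : pathFlow n A k ≤ 0 := by
        unfold pathFlow
        split_ifs with hlt
        · have hk' : k - 1 < n := by omega
          have := ha (show (⟨k - 1, hk'⟩ : Fin n) ≤ ⟨k, hlt.2⟩ from Nat.sub_le k 1)
          simp only [A, hlt.2, hk', dite_true]
          omega
        · exact le_rfl
      have := h k hkn
      omega
  · rintro ⟨hsum, hle⟩
    let a : ℕ → ℕ := fun i => ∑ k ∈ Ico (i + 1) n, (partialSum l k - partialSum μ k)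
    refine ⟨fun i => a i, fun i j hij => ?_, ?_⟩
    · exact Finset.sum_le_sum_of_subset
        (Finset.Ico_subset_Ico (Nat.succ_le_succ hij) le_rfl)
    · rw [eq_topT_pathG_iff fun i => (a i : ℤ)]
      intro k hk
      unfold pathFlow
      split_ifs with hlt
      · have hstep : a (k - 1) = (partialSum l k - partialSum μ k) + a k := by
          simp only [a, Nat.sub_add_cancel hlt.1]
          exact Finset.sum_eq_sum_Ico_succ_bot hlt.2 _
        have := hle k hlt.1 hk
        dsimp only
        omega
      · obtain rfl | rfl : k = 0 ∨ k = n := by omega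
        · simp [partialSum_zero]
        · rw [partialSum_self, partialSum_self, hsum, add_zero]
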